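/- arXiv:1209.6338 — 2 statements merged into one kernel-verified Lean document; each statement's English description precedes it below -/
import Mathlib

section
/- Let H be a Hilbert space, P an orthogonal projection on H, and T a self-adjoint Hilbert–Schmidt operator with PTP and (I-P)T(I-P) both trace class. Then the generalized trace tr_P(T) := tr(PTP) + tr((I-P)T(I-P)) is well-defined and real, and if T is trace class then tr_P(T) = tr(T). -/
open scoped InnerProductSpace

variable {H : Type*} [NormedAddCommGroup H] [InnerProductSpace ℂ H] [CompleteSpace H]

/-- The diagonal sum of an operator in a given Hilbert basis (the trace, when it exists). -/
noncomputable def diagTrace {ι : Type*} (e : HilbertBasis ι ℂ H) (T : H →L[ℂ] H) : ℂ :=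
  ∑' i : ι, ⟪e i, T (e i)⟫_ℂ

/-- An operator is trace class when its diagonal is absolutely summable in every
Hilbert basis. -/
def IsTraceClassOp {ι : Type*} (_ : HilbertBasis ι ℂ H) (T : H →L[ℂ] H) : Prop :=
  ∀ f : HilbertBasis ι ℂ H, Summable fun i : ι => ‖⟪f i, T (f i)⟫_ℂ‖

lemma hb_embed {ι κ : Type*} [Infinite ι] (e : HilbertBasis ι ℂ H) (f : HilbertBasis κ ℂ H) :
    Nonempty (κ ↪ ι) := by
  classical
  have h0 : ∀ k, ∃ i, ⟪e i, f k⟫_ℂ ≠ 0 := by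
    intro k
    by_contra! hcon
    have h := e.hasSum_inner_mul_inner (f k) (f k)
    simp only [hcon, mul_zero] at h
    have h2 := h.unique hasSum_zero
    have h3 := f.orthonormal.ne_zero k
    exact h3 (inner_self_eq_zero.1 h2)
  choose a ha using h0
  have hc : ∀ i, (Set.Countable {k | ⟪e i, f k⟫_ℂ ≠ 0}) := by
    intro i
    have h := (f.summable_inner_mul_inner (e i) (e i)).countable_support
    refine h.mono ?_
    intro k hk
    simp only [Function.mem_support, ne_eq, mul_eq_zero, not_or]
    refine ⟨hk, fun h' => hk ?_⟩
    rw [← inner_conj_symm, h', map_zero]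
  have hc' : ∀ i, ∃ g : κ → ℕ, Set.InjOn g {k | ⟪e i, f k⟫_ℂ ≠ 0} := fun i =>
    Set.countable_iff_exists_injOn.1 (hc i)
  choose g hg using hc'
  have hinj : Function.Injective (fun k => (a k, g (a k) k)) := by
    intro k l hkl
    simp only [Prod.mk.injEq] at hkl
    obtain ⟨h1, h2⟩ := hkl
    rw [← h1] at h2
    refine hg (a k) (ha k) ?_ h2
    have := ha l
    rw [← h1] at this
    exact this
  have he : Nonempty (ι × ℕ ≃ ι) := by
    rw [← Cardinal.eq, Cardinal.mk_prod]
    simp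
  exact ⟨(⟨_, hinj⟩ : κ ↪ ι × ℕ).trans he.some.toEmbedding⟩

lemma hb_equiv_fin {ι κ : Type*} [Finite ι] (e : HilbertBasis ι ℂ H) (f : HilbertBasis κ ℂ H) :
    Nonempty (κ ≃ ι) := by
  classical
  haveI := Fintype.ofFinite ι
  let b := e.toOrthonormalBasis.toBasis
  haveI : FiniteDimensional ℂ H := b.finiteDimensional_of_finite
  haveI : Finite κ := f.orthonormal.linearIndependent.finite
  haveI := Fintype.ofFinite κ
  exact ⟨f.toOrthonormalBasis.toBasis.indexEquiv b⟩

lemma hb_equiv {ι κ : Type*} (e : HilbertBasis ι ℂ H) (f : HilbertBasis κ ℂ H) :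
    Nonempty (κ ≃ ι) := by
  rcases finite_or_infinite ι with h | h
  · exact hb_equiv_fin e f
  rcases finite_or_infinite κ with h' | h'
  · exact (hb_equiv_fin f e).map Equiv.symm
  obtain ⟨a⟩ := hb_embed e f
  obtain ⟨b⟩ := hb_embed f e
  exact Function.Embedding.antisymm a b

/-- A Hilbert basis indexed by `ι` adapted to a closed subspace. -/
lemma hb_adapted {ι : Type*} (e : HilbertBasis ι ℂ H) (K : Submodule ℂ H)
    (hK : IsClosed (K : Set H)) :
    ∃ g : HilbertBasis ι ℂ H, ∀ i, g i ∈ K ∨ g i ∈ Kᗮ := by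
  haveI : CompleteSpace K := hK.completeSpace_coe
  obtain ⟨w0, b0, hb0⟩ := exists_hilbertBasis ℂ K
  have ho : Orthonormal ℂ (fun k => ((b0 k : K) : H)) :=
    b0.orthonormal.comp_linearIsometry K.subtypeₗᵢ
  obtain ⟨w, b, hsw, hb⟩ := ho.toSubtypeRange.exists_hilbertBasis_extension
  have key : ∀ k, b k ∈ K ∨ b k ∈ Kᗮ := by
    intro k
    by_cases hk : (k : H) ∈ Set.range (fun k => ((b0 k : K) : H))
    · left
      rw [hb]
      obtain ⟨l, hl⟩ := hk
      rw [← hl]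
      exact (b0 l).2
    · right
      have h1 : ∀ l, ⟪((b0 l : K) : H), b k⟫_ℂ = 0 := by
        intro l
        have hl := hsw ⟨l, rfl⟩
        have h2 := b.orthonormal.2 (i := ⟨_, hl⟩) (j := k) (by
          intro h
          exact hk ⟨l, congrArg Subtype.val h⟩)
        simpa [hb] using h2
      rw [Submodule.mem_orthogonal]
      intro u hu
      have h3 := (b0.hasSum_repr ⟨u, hu⟩).mapL (K.subtypeL)
      have h4 := h3.mapL (innerSL ℂ (b k))
      have h5 : ∀ l, ⟪b k, ((b0 l : K) : H)⟫_ℂ = 0 := fun l => by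
        rw [← inner_conj_symm, h1, map_zero]
      simp only [map_smul, Submodule.subtypeL_apply, innerSL_apply_apply, h5, smul_zero] at h4
      rw [← inner_conj_symm, h4.unique hasSum_zero, map_zero]
  obtain ⟨φ⟩ := hb_equiv e b
  have hr : Set.range (b ∘ φ.symm) = Set.range b := φ.symm.surjective.range_comp b
  refine ⟨HilbertBasis.mk (b.orthonormal.comp φ.symm φ.symm.injective) ?_, ?_⟩
  · rw [hr, b.dense_span]
  · intro i
    rw [HilbertBasis.coe_mk]
    exact key _

lemma hb_hasSum_sq {ι : Type*} (f : HilbertBasis ι ℂ H) (x : H) :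
    ∑' j, ENNReal.ofReal (‖⟪f j, x⟫_ℂ‖ ^ 2) = ENNReal.ofReal (‖x‖ ^ 2) := by
  have h := (f.hasSum_inner_mul_inner x x).mapL Complex.reCLM
  have h2 : HasSum (fun j => ‖⟪f j, x⟫_ℂ‖ ^ 2) (‖x‖ ^ 2) := by
    convert h using 1
    · ext j
      rw [← inner_conj_symm x (f j), Complex.conj_mul']
      simp [← Complex.ofReal_pow]
    · rw [inner_self_eq_norm_sq_to_K]
      simp [← Complex.ofReal_pow]
  rw [← h2.tsum_eq, ENNReal.ofReal_tsum_of_nonneg (fun _ => by positivity) h2.summable]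

lemma hb_swap {ι : Type*} (f g : HilbertBasis ι ℂ H) (B : H →L[ℂ] H) :
    ∑' i, ENNReal.ofReal (‖B (g i)‖ ^ 2) =
      ∑' j, ENNReal.ofReal (‖(ContinuousLinearMap.adjoint B) (f j)‖ ^ 2) := by
  simp_rw [← hb_hasSum_sq f (B _), ← hb_hasSum_sq g (ContinuousLinearMap.adjoint B _)]
  rw [ENNReal.tsum_comm]
  refine tsum_congr fun j => tsum_congr fun i => ?_
  rw [ContinuousLinearMap.adjoint_inner_right, norm_inner_symm, norm_inner_symm,
    ← norm_inner_symm]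

lemma hb_indep {ι : Type*} (f g : HilbertBasis ι ℂ H) (B : H →L[ℂ] H) :
    ∑' i, ENNReal.ofReal (‖B (g i)‖ ^ 2) = ∑' i, ENNReal.ofReal (‖B (f i)‖ ^ 2) := by
  rw [hb_swap f g, ← hb_swap f f]

lemma hb_indep_hasSum {ι : Type*} (f g : HilbertBasis ι ℂ H) (B : H →L[ℂ] H)
    (h : Summable fun i => ‖B (g i)‖ ^ 2) :
    HasSum (fun i => ‖B (f i)‖ ^ 2) (∑' i, ‖B (g i)‖ ^ 2) := by
  have h1 := hb_indep f g B
  rw [← ENNReal.ofReal_tsum_of_nonneg (fun _ => by positivity) h] at h1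
  have h2 : Summable fun i => ‖B (f i)‖ ^ 2 := by
    have h3 := ENNReal.summable_toReal (f := fun i => ENNReal.ofReal (‖B (f i)‖ ^ 2))
      (by rw [← h1]; exact ENNReal.ofReal_ne_top)
    simpa [ENNReal.toReal_ofReal] using h3
  rw [← ENNReal.ofReal_tsum_of_nonneg (fun _ => by positivity) h2,
    ENNReal.ofReal_eq_ofReal_iff (tsum_nonneg fun _ => by positivity)
      (tsum_nonneg fun _ => by positivity)] at h1
  rw [h1]
  exact h2.hasSum

/-- Basis independence of the trace for self-adjoint operators. -/
lemma trace_indep {ι : Type*} (e : HilbertBasis ι ℂ H) (A : H →L[ℂ] H) (hA : IsSelfAdjoint A)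
    (h : IsTraceClassOp e A) (f : HilbertBasis ι ℂ H) : diagTrace f A = diagTrace e A := by
  obtain ⟨B, hB⟩ := CStarAlgebra.nonneg_iff_eq_star_mul_self.1 (CFC.posPart_nonneg A)
  obtain ⟨C, hC⟩ := CStarAlgebra.nonneg_iff_eq_star_mul_self.1 (CFC.negPart_nonneg A)
  have hsub := CFC.posPart_sub_negPart A hA
  have hmul := CFC.negPart_mul_posPart A
  have hsp : IsSelfAdjoint (A⁺) := (CFC.posPart_nonneg A).isSelfAdjoint
  have hp : ∀ x : H, ⟪x, A⁺ x⟫_ℂ = ((‖B x‖ ^ 2 : ℝ) : ℂ) := by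
    intro x
    rw [hB, ContinuousLinearMap.star_eq_adjoint, ContinuousLinearMap.mul_apply,
      ContinuousLinearMap.adjoint_inner_right, inner_self_eq_norm_sq_to_K]
    simp
  have hn : ∀ x : H, ⟪x, A⁻ x⟫_ℂ = ((‖C x‖ ^ 2 : ℝ) : ℂ) := by
    intro x
    rw [hC, ContinuousLinearMap.star_eq_adjoint, ContinuousLinearMap.mul_apply,
      ContinuousLinearMap.adjoint_inner_right, inner_self_eq_norm_sq_to_K]
    simp
  have hd : ∀ x : H, ⟪x, A x⟫_ℂ = ((‖B x‖ ^ 2 - ‖C x‖ ^ 2 : ℝ) : ℂ) := by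
    intro x
    conv_lhs => rw [← hsub]
    rw [ContinuousLinearMap.sub_apply, inner_sub_right, hp, hn, ← Complex.ofReal_sub]
  obtain ⟨g, hg⟩ := hb_adapted e (LinearMap.ker (A⁻ : H →L[ℂ] H).toLinearMap)
    (ContinuousLinearMap.isClosed_ker (A⁻ : H →L[ℂ] H))
  have hz : ∀ i, C (g i) = 0 ∨ B (g i) = 0 := by
    intro i
    rcases hg i with h' | h'
    · left
      have h1 : (A⁻ : H →L[ℂ] H) (g i) = 0 := h'
      have h2 := hn (g i)
      rw [h1, inner_zero_right] at h2
      have h3 : ‖C (g i)‖ ^ 2 = 0 := by exact_mod_cast h2.symm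
      simpa using h3
    · right
      have h1 : ⟪(A⁺ : H →L[ℂ] H) (g i), g i⟫_ℂ = 0 := by
        rw [Submodule.mem_orthogonal] at h'
        apply h'
        have := congrArg (fun S : H →L[ℂ] H => S (g i)) hmul
        exact this
      have h2 := hp (g i)
      rw [← inner_conj_symm, h1, map_zero] at h2
      have h3 : ‖B (g i)‖ ^ 2 = 0 := by exact_mod_cast h2.symm
      simpa using h3
  have hs := h g
  have hsB : Summable fun i => ‖B (g i)‖ ^ 2 := by
    refine Summable.of_nonneg_of_le (fun _ => by positivity) (fun i => ?_) hs
    rw [hd, Complex.norm_real]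
    rcases hz i with h' | h' <;> simp [h']
  have hsC : Summable fun i => ‖C (g i)‖ ^ 2 := by
    refine Summable.of_nonneg_of_le (fun _ => by positivity) (fun i => ?_) hs
    rw [hd, Complex.norm_real]
    rcases hz i with h' | h' <;> simp [h']
  have fin : ∀ f : HilbertBasis ι ℂ H,
      diagTrace f A = ((∑' i, ‖B (g i)‖ ^ 2 - ∑' i, ‖C (g i)‖ ^ 2 : ℝ) : ℂ) := by
    intro f
    have h1 := (hb_indep_hasSum f g B hsB).sub (hb_indep_hasSum f g C hsC)
    have h2 := Complex.hasSum_ofReal.2 h1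
    unfold diagTrace
    simp_rw [hd]
    exact h2.tsum_eq
  rw [fin f, fin e]

lemma diag_im {ι : Type*} (e : HilbertBasis ι ℂ H) (A : H →L[ℂ] H) (hA : IsSelfAdjoint A) :
    (diagTrace e A).im = 0 := by
  have h : ∀ x : H, ⟪x, A x⟫_ℂ = (((⟪x, A x⟫_ℂ).re : ℝ) : ℂ) := by
    intro x
    have h1 : (starRingEnd ℂ) ⟪x, A x⟫_ℂ = ⟪x, A x⟫_ℂ := by
      rw [inner_conj_symm, ← ContinuousLinearMap.adjoint_inner_right, hA.adjoint_eq]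
    exact (Complex.conj_eq_iff_re.1 h1).symm
  unfold diagTrace
  rw [tsum_congr fun i => h (e i), ← Complex.ofReal_tsum, Complex.ofReal_im]

/-- The generalized `P`-trace `tr_P(T) = tr(PTP) + tr((I-P)T(I-P))` is well defined
(basis independent) and real for a self-adjoint Hilbert–Schmidt operator `T` whose
diagonal blocks are trace class, and it coincides with the trace when `T` is trace class. -/
theorem traceP_welldefined_real_and_consistent {ι : Type*}
    (e : HilbertBasis ι ℂ H) (P T : H →L[ℂ] H)
    (hPproj : P ∘L P = P) (hPsa : IsSelfAdjoint P) (hTsa : IsSelfAdjoint T)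
    (hTHS : ∀ f : HilbertBasis ι ℂ H, Summable fun i : ι => ‖T (f i)‖ ^ 2)
    (h1 : IsTraceClassOp e (P ∘L T ∘L P))
    (h2 : IsTraceClassOp e ((1 - P) ∘L T ∘L (1 - P))) :
    (∀ f : HilbertBasis ι ℂ H,
      diagTrace f (P ∘L T ∘L P) + diagTrace f ((1 - P) ∘L T ∘L (1 - P)) =
        diagTrace e (P ∘L T ∘L P) + diagTrace e ((1 - P) ∘L T ∘L (1 - P))) ∧
    (diagTrace e (P ∘L T ∘L P) + diagTrace e ((1 - P) ∘L T ∘L (1 - P))).im = 0 ∧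
    (IsTraceClassOp e T →
      diagTrace e (P ∘L T ∘L P) + diagTrace e ((1 - P) ∘L T ∘L (1 - P)) =
        diagTrace e T) := by
  have hsP : ∀ Q : H →L[ℂ] H, IsSelfAdjoint Q → IsSelfAdjoint (Q ∘L T ∘L Q) := by
    intro Q hQ
    have h := hTsa.conjugate Q
    rw [hQ.star_eq] at h
    exact h
  have hQsa : IsSelfAdjoint (1 - P) := (IsSelfAdjoint.one _).sub hPsa
  have s1 := hsP P hPsa
  have s2 := hsP (1 - P) hQsa
  refine ⟨fun f => ?_, ?_, fun hT => ?_⟩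
  · rw [trace_indep e _ s1 h1 f, trace_indep e _ s2 h2 f]
  · rw [Complex.add_im, diag_im e _ s1, diag_im e _ s2, add_zero]
  · obtain ⟨g, hg⟩ := hb_adapted e (LinearMap.ker P.toLinearMap)
      (ContinuousLinearMap.isClosed_ker P)
    rw [← trace_indep e _ s1 h1 g, ← trace_indep e _ s2 h2 g, ← trace_indep e _ hTsa hT g]
    unfold diagTrace
    rw [← (h1 g).of_norm.tsum_add (h2 g).of_norm]
    refine tsum_congr fun i => ?_
    have hsym : ∀ x y, ⟪x, P y⟫_ℂ = ⟪P x, y⟫_ℂ := fun x y => by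
      rw [← ContinuousLinearMap.adjoint_inner_right, hPsa.adjoint_eq]
    have hPP : ∀ x, P (P x) = P x := fun x => congrArg (fun S : H →L[ℂ] H => S x) hPproj
    have hgi : P (g i) = 0 ∨ P (g i) = g i := by
      rcases hg i with h | h
      · exact Or.inl h
      · right
        have hk : P (g i) - g i ∈ LinearMap.ker P.toLinearMap := by
          simp [hPP]
        rw [Submodule.mem_orthogonal] at h
        have h3 := h _ hk
        have h4 : ⟪P (g i) - g i, P (g i)⟫_ℂ = 0 := by
          rw [hsym, map_sub, hPP, sub_self, inner_zero_left]
        have h5 : ⟪P (g i) - g i, P (g i) - g i⟫_ℂ = 0 := by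
          rw [inner_sub_right, h3, h4, sub_self]
        exact sub_eq_zero.1 (inner_self_eq_zero.1 h5)
    simp only [ContinuousLinearMap.comp_apply, ContinuousLinearMap.sub_apply,
      ContinuousLinearMap.one_apply, inner_sub_right, hsym]
    rcases hgi with h | h <;> simp [h]
end

section
/- Let P and Q be orthogonal projections on a Hilbert space such that Q - P is Hilbert–Schmidt and the diagonal blocks P(Q-P)P and (I-P)(Q-P)(I-P) are trace class. Then tr_P(Q-P) := tr(P(Q-P)P) + tr((I-P)(Q-P)(I-P)) is an integer. -/
open scoped InnerProductSpace

variable {H : Type*} [NormedAddCommGroup H] [InnerProductSpace ℂ H] [CompleteSpace H]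

namespace RelCharge

set_option linter.unusedSectionVars false

/-- Parseval identity. -/
lemma parseval {ι : Type*} {H : Type*} [NormedAddCommGroup H] [InnerProductSpace ℂ H]
    (e : HilbertBasis ι ℂ H) (x : H) :
    HasSum (fun j => ‖⟪e j, x⟫_ℂ‖ ^ 2) (‖x‖ ^ 2) := by
  have h := e.hasSum_inner_mul_inner x x
  rw [inner_self_eq_norm_sq_to_K] at h
  rw [← Complex.hasSum_ofReal]
  convert! h using 1
  · funext j
    rw [← inner_conj_symm x (e j), mul_comm, RCLike.mul_conj]
    simp
  · simp

/-- Hilbert-Schmidt in the basis `e`. -/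
def HS {ι : Type*} (e : HilbertBasis ι ℂ H) (X : H →L[ℂ] H) : Prop :=
  Summable fun i => ‖X (e i)‖ ^ 2

lemma HS.pair {ι : Type*} {e : HilbertBasis ι ℂ H} {X : H →L[ℂ] H} (h : HS e X) :
    Summable fun p : ι × ι => ‖⟪e p.2, X (e p.1)⟫_ℂ‖ ^ 2 := by
  rw [summable_prod_of_nonneg (fun p => by positivity)]
  refine ⟨fun i => (parseval e (X (e i))).summable, ?_⟩
  have : (fun i => ∑' j, ‖⟪e j, X (e i)⟫_ℂ‖ ^ 2) = fun i => ‖X (e i)‖ ^ 2 := by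
    ext i; exact (parseval e (X (e i))).tsum_eq
  simp only [this]
  exact h

lemma HS.star {ι : Type*} {e : HilbertBasis ι ℂ H} {X : H →L[ℂ] H} (h : HS e X) :
    HS e (star X) := by
  have h1 := h.pair.prod_symm
  rw [summable_prod_of_nonneg (fun p => by positivity)] at h1
  have h2 := h1.2
  have : (fun i => ∑' j, ‖⟪e i, X (e j)⟫_ℂ‖ ^ 2) = fun i => ‖(Star.star X) (e i)‖ ^ 2 := by
    ext i
    rw [← (parseval e _).tsum_eq]
    congr 1
    ext j
    rw [ContinuousLinearMap.star_eq_adjoint, ContinuousLinearMap.adjoint_inner_right,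
      ← inner_conj_symm, RCLike.norm_conj]
  simp only [Prod.swap] at h2
  rw [this] at h2
  exact h2

lemma HS.mul_left {ι : Type*} {e : HilbertBasis ι ℂ H} {X : H →L[ℂ] H} (h : HS e X)
    (Y : H →L[ℂ] H) : HS e (Y * X) := by
  refine Summable.of_nonneg_of_le (fun i => by positivity) (fun i => ?_) (Summable.mul_left (‖Y‖ ^ 2) h)
  rw [← mul_pow]
  gcongr
  exact Y.le_opNorm _

lemma HS.mul_right {ι : Type*} {e : HilbertBasis ι ℂ H} {X : H →L[ℂ] H} (h : HS e X)
    (Y : H →L[ℂ] H) : HS e (X * Y) := by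
  have := (h.star.mul_left (Star.star Y)).star
  simpa using this

lemma prod_le {a b : ℝ} : a * b ≤ a ^ 2 + b ^ 2 := by nlinarith [sq_nonneg (a - b), sq_nonneg a, sq_nonneg b]

lemma summable_inner {ι : Type*} {e : HilbertBasis ι ℂ H} {X Y : H →L[ℂ] H}
    (hX : HS e X) (hY : HS e Y) : Summable fun i => ⟪X (e i), Y (e i)⟫_ℂ := by
  refine Summable.of_norm_bounded (Summable.add hX hY) fun i => ?_
  exact (norm_inner_le_norm _ _).trans prod_le

/-- diagonal of a product of two HS operators is summable -/
lemma summable_mul {ι : Type*} {e : HilbertBasis ι ℂ H} {X Y : H →L[ℂ] H}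
    (hX : HS e X) (hY : HS e Y) : Summable fun i => ⟪e i, (X * Y) (e i)⟫_ℂ := by
  have := summable_inner hX.star hY
  refine this.congr fun i => ?_
  rw [ContinuousLinearMap.star_eq_adjoint, ContinuousLinearMap.adjoint_inner_left]
  rfl

lemma inner_mul_tsum {ι : Type*} (e : HilbertBasis ι ℂ H) (X Y : H →L[ℂ] H) (i : ι) :
    ⟪e i, (X * Y) (e i)⟫_ℂ = ∑' j, ⟪e i, X (e j)⟫_ℂ * ⟪e j, Y (e i)⟫_ℂ := by
  have := e.tsum_inner_mul_inner (Star.star X (e i)) (Y (e i))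
  simp only [ContinuousLinearMap.star_eq_adjoint, ContinuousLinearMap.adjoint_inner_left] at this
  exact this.symm

/-- cyclicity of the trace -/
lemma trace_comm {ι : Type*} {e : HilbertBasis ι ℂ H} {X Y : H →L[ℂ] H}
    (hX : HS e X) (hY : HS e Y) : diagTrace e (X * Y) = diagTrace e (Y * X) := by
  unfold diagTrace
  simp_rw [inner_mul_tsum]
  rw [Summable.tsum_comm]
  · simp_rw [mul_comm]
  · refine Summable.of_norm_bounded (Summable.add hX.pair hY.pair.prod_symm) fun p => ?_
    simp only [Function.uncurry, norm_mul, Prod.swap]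
    exact prod_le

/-- trace of a HS projection is a natural number -/
lemma trace_proj {ι : Type*} {e : HilbertBasis ι ℂ H} {R : H →L[ℂ] H}
    (hR : IsStarProjection R) (hS : HS e R) : ∃ n : ℕ, diagTrace e R = n := by
  obtain ⟨K, hK, rfl⟩ := (isStarProjection_iff_eq_starProjection).1 hR
  have : CompleteSpace K := by
    have : IsClosed (K : Set H) := by
      rw [← Submodule.orthogonal_orthogonal K]; exact Submodule.isClosed_orthogonal _
    exact this.completeSpace_coe
  obtain ⟨w, b, hb⟩ := exists_hilbertBasis ℂ K
  -- norm squares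
  have hn : ∀ x : H, HasSum (fun j : w => ‖⟪x, (b j : H)⟫_ℂ‖ ^ 2) (‖K.starProjection x‖ ^ 2) := by
    intro x
    have := parseval b (K.orthogonalProjectionOnto x)
    convert! this using 1
    funext j
    rw [Submodule.coe_inner, ← Submodule.starProjection_apply, ← inner_conj_symm, RCLike.norm_conj,
      ← Submodule.inner_starProjection_left_eq_right, Submodule.starProjection_eq_self_iff.2 (b j).2]
  have hp : Summable fun p : ι × w => ‖⟪e p.1, (b p.2 : H)⟫_ℂ‖ ^ 2 := by
    rw [summable_prod_of_nonneg (fun p => by positivity)]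
    refine ⟨fun i => (hn (e i)).summable, ?_⟩
    simp_rw [fun i => (hn (e i)).tsum_eq]
    exact hS
  have hcol : ∀ j : w, HasSum (fun i => ‖⟪e i, (b j : H)⟫_ℂ‖ ^ 2) 1 := by
    intro j
    have := parseval e (b j : H)
    have h1 : ‖(b j : H)‖ = 1 := b.orthonormal.1 j
    rw [h1, one_pow] at this
    exact this
  have hsum1 : Summable fun _ : w => (1 : ℝ) := by
    have := hp.prod_symm
    rw [summable_prod_of_nonneg (fun p => by positivity)] at this
    have h2 := this.2
    simp only [Prod.swap] at h2
    simpa only [fun j => (hcol j).tsum_eq] using h2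
  have hfin : Finite w := by
    by_contra hinf
    rw [not_finite_iff_infinite] at hinf
    have := hsum1.tendsto_cofinite_zero
    rw [tendsto_const_nhds_iff] at this
    exact one_ne_zero this
  have := Fintype.ofFinite w
  refine ⟨Fintype.card w, ?_⟩
  have h3 : ∑' i, ‖K.starProjection (e i)‖ ^ 2 = (Fintype.card w : ℝ) := by
    calc ∑' i, ‖K.starProjection (e i)‖ ^ 2
        = ∑' i, ∑' j : w, ‖⟪e i, (b j : H)⟫_ℂ‖ ^ 2 :=
          tsum_congr fun i => (hn (e i)).tsum_eq.symm
      _ = ∑' j : w, ∑' i, ‖⟪e i, (b j : H)⟫_ℂ‖ ^ 2 := Summable.tsum_comm hp.prod_symm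
      _ = ∑' _ : w, (1 : ℝ) := tsum_congr fun j => (hcol j).tsum_eq
      _ = (Fintype.card w : ℝ) := by rw [tsum_fintype]; simp
  unfold diagTrace
  have h4 : ∀ i, ⟪e i, K.starProjection (e i)⟫_ℂ = ((‖K.starProjection (e i)‖ ^ 2 : ℝ) : ℂ) := by
    intro i
    have h5 : K.starProjection (e i) = K.starProjection (K.starProjection (e i)) :=
      (Submodule.starProjection_eq_self_iff.2 (Submodule.starProjection_apply_mem K (e i))).symm
    have h6 : ⟪e i, K.starProjection (K.starProjection (e i))⟫_ℂ =
        ⟪K.starProjection (e i), K.starProjection (e i)⟫_ℂ :=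
      (Submodule.inner_starProjection_left_eq_right K _ _).symm
    rw [← h5, inner_self_eq_norm_sq_to_K] at h6
    rw [h6]
    simp
  simp only [h4]
  rw [← Complex.ofReal_tsum, h3]
  simp

section ringfacts

variable {R : Type*} [Ring R] {p q : R}

lemma alg_anti (hp : p * p = p) (hq : q * q = q) :
    (1 - p - q) * (q - p) = -((q - p) * (1 - p - q)) := by
  simp only [mul_sub, sub_mul, mul_one, one_mul, hp, hq]
  abel

lemma alg_sq (hp : p * p = p) (hq : q * q = q) :
    (1 - p - q) * (1 - p - q) = 1 - (q - p) * (q - p) := by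
  simp only [mul_sub, sub_mul, mul_one, one_mul, hp, hq]
  abel

lemma alg_commp (hp : p * p = p) (hq : q * q = q) :
    p * ((q - p) * (q - p)) = (q - p) * (q - p) * p := by
  have h1 : ∀ x, p * (p * x) = p * x := fun x => by rw [← mul_assoc, hp]
  simp only [mul_sub, sub_mul, mul_one, one_mul, hp, hq, mul_assoc, h1]
  abel

lemma alg_commq (hp : p * p = p) (hq : q * q = q) :
    q * ((q - p) * (q - p)) = (q - p) * (q - p) * q := by
  have h1 : ∀ x, q * (q * x) = q * x := fun x => by rw [← mul_assoc, hq]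
  simp only [mul_sub, sub_mul, mul_one, one_mul, hp, hq, mul_assoc, h1]
  abel

lemma alg_diag (hp : p * p = p) (hq : q * q = q) :
    p * ((q - p) * p) + (1 - p) * ((q - p) * (1 - p)) =
      (q - p) * ((q - p) * (q - p)) + (q - p) * ((q - p) * (1 - p - q)) := by
  have h1 : ∀ x, q * (q * x) = q * x := fun x => by rw [← mul_assoc, hq]
  have h2 : ∀ x, p * (p * x) = p * x := fun x => by rw [← mul_assoc, hp]
  simp only [mul_sub, sub_mul, mul_one, one_mul, hp, hq, mul_assoc, h1, h2]
  abel

lemma alg_pow_comm {a b : R} (h : b * a = -(a * b)) (k : ℕ) :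
    b * (a * a) ^ k = (a * a) ^ k * b := by
  have : Commute b (a * a) := by
    change b * (a * a) = a * a * b
    rw [← mul_assoc, h, neg_mul, mul_assoc, h, mul_neg, neg_neg, mul_assoc]
  exact (this.pow_right k).eq

end ringfacts

lemma trace_neg {ι : Type*} (e : HilbertBasis ι ℂ H) (X : H →L[ℂ] H) :
    diagTrace e (-X) = -diagTrace e X := by
  unfold diagTrace
  rw [← tsum_neg]
  simp

lemma trace_zero_of_anti {ι : Type*} {e : HilbertBasis ι ℂ H} {X Y : H →L[ℂ] H}
    (hX : HS e X) (hY : HS e Y) (h : Y * X = -(X * Y)) : diagTrace e (X * Y) = 0 := by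
  have h1 := trace_comm hX hY
  rw [h, trace_neg] at h1
  exact self_eq_neg.1 h1

/-- Step of the recursion `tr A^{2k+3} = tr A^{2k+5}`. -/
lemma trace_step {ι : Type*} {e : HilbertBasis ι ℂ H} {A B : H →L[ℂ] H}
    (hA : HS e A) (hBA : B * A = -(A * B)) (hB : B * B = 1 - A * A) (k : ℕ) :
    diagTrace e (A * ((A * A) ^ k * (A * A))) =
      diagTrace e (A * ((A * A) ^ (k + 1) * (A * A))) := by
  have hc := alg_pow_comm hBA (k + 1)
  have h1 : HS e (A * B) := hA.mul_right B
  have h2 : HS e ((A * A) ^ (k + 1) * B) := by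
    rw [pow_succ', mul_assoc, mul_assoc]
    exact hA.mul_right _
  have h3 : (A * B) * ((A * A) ^ (k + 1) * B) =
      A * ((A * A) ^ k * (A * A)) - A * ((A * A) ^ (k + 1) * (A * A)) := by
    calc (A * B) * ((A * A) ^ (k + 1) * B) = A * (B * (A * A) ^ (k + 1)) * B := by
          simp only [mul_assoc]
      _ = A * (A * A) ^ (k + 1) * (B * B) := by rw [hc]; simp only [mul_assoc]
      _ = _ := by rw [hB, mul_sub, mul_one, pow_succ]; simp only [mul_assoc]
  have hAc : A * (A * A) ^ (k + 1) = (A * A) ^ (k + 1) * A := by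
    have : Commute A (A * A) := (Commute.refl A).mul_right (Commute.refl A)
    exact (this.pow_right (k + 1)).eq
  have h4 : ((A * A) ^ (k + 1) * B) * (A * B) = - ((A * B) * ((A * A) ^ (k + 1) * B)) := by
    calc ((A * A) ^ (k + 1) * B) * (A * B) = (A * A) ^ (k + 1) * (B * A) * B := by
          simp only [mul_assoc]
      _ = - ((A * A) ^ (k + 1) * A * (B * B)) := by
          rw [hBA]; simp only [mul_neg, neg_mul, mul_assoc]
      _ = - (A * (B * (A * A) ^ (k + 1)) * B) := by rw [← hAc, hc]; simp only [mul_assoc]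
      _ = _ := by simp only [mul_assoc]
  have h5 := trace_zero_of_anti h1 h2 h4
  rw [h3] at h5
  have s1 : ∀ k, Summable fun i => ⟪e i, (A * ((A * A) ^ k * (A * A))) (e i)⟫_ℂ := fun k =>
    summable_mul hA ((hA.mul_left A).mul_left _)
  unfold diagTrace at h5 ⊢
  rw [← sub_eq_zero, ← (s1 k).tsum_sub (s1 (k + 1)), ← h5]
  refine tsum_congr fun i => ?_
  rw [sub_apply, inner_sub_right]

lemma trace_const {ι : Type*} {e : HilbertBasis ι ℂ H} {A B : H →L[ℂ] H}
    (hA : HS e A) (hBA : B * A = -(A * B)) (hB : B * B = 1 - A * A) (k : ℕ) :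
    diagTrace e (A * ((A * A) ^ k * (A * A))) = diagTrace e (A * (A * A)) := by
  induction k with
  | zero => simp
  | succ k ih => rw [← trace_step hA hBA hB, ih]

/-- Limit step -/
lemma trace_limit {ι : Type*} {e : HilbertBasis ι ℂ H} {A B : H →L[ℂ] H}
    (hA : HS e A) (hBA : B * A = -(A * B)) (hB : B * B = 1 - A * A) (hsa : IsSelfAdjoint A)
    (hn : ‖A‖ ≤ 1) :
    diagTrace e (A * (A * A)) = diagTrace e
      (A * (((A * A).eqLocus (1 : H →L[ℂ] H)).starProjection * (A * A))) := by
  have hn2 : ‖A * A‖ ≤ 1 := (norm_mul_le A A).trans (by nlinarith [norm_nonneg A])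
  have hmove : ∀ x y, ⟪x, A y⟫_ℂ = ⟪A x, y⟫_ℂ := fun x y => by
    conv_rhs => rw [← hsa.star_eq, ContinuousLinearMap.star_eq_adjoint,
      ContinuousLinearMap.adjoint_inner_left]
  set f := A * A with hf
  have hiter : ∀ (k : ℕ) (x : H), f^[k] x = (f ^ k) x := fun k x => by
    induction k generalizing x with
    | zero => rfl
    | succ k ih =>
      rw [Function.iterate_succ_apply, ih, pow_succ]
      rfl
  have hlim : Filter.Tendsto (fun N : ℕ => ∑' i, ⟪A (e i), birkhoffAverage ℂ f _root_.id N (f (e i))⟫_ℂ)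
      Filter.atTop (nhds (∑' i, ⟪A (e i), (f.eqLocus (1 : H →L[ℂ] H)).starProjection (f (e i))⟫_ℂ)) := by
    refine tendsto_tsum_of_dominated_convergence (bound := fun i => ‖A (e i)‖ ^ 2) hA ?_ ?_
    · intro i
      exact tendsto_const_nhds.inner (f.tendsto_birkhoffAverage_orthogonalProjection hn2 (f (e i)))
    · refine Filter.Eventually.of_forall fun N i => ?_
      have hfx : ‖f (e i)‖ ≤ ‖A (e i)‖ := by
        calc ‖A (A (e i))‖ ≤ ‖A‖ * ‖A (e i)‖ := A.le_opNorm _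
          _ ≤ 1 * ‖A (e i)‖ := by gcongr
          _ = _ := one_mul _
      have hit : ∀ k, ‖f^[k] (f (e i))‖ ≤ ‖A (e i)‖ := by
        intro k
        induction k with
        | zero => simpa using hfx
        | succ k ih =>
          rw [Function.iterate_succ_apply']
          exact (f.le_of_opNorm_le hn2 _).trans (by simpa using ih)
      have hb : ‖birkhoffAverage ℂ f _root_.id N (f (e i))‖ ≤ ‖A (e i)‖ := by
        unfold birkhoffAverage birkhoffSum
        rw [norm_smul, norm_inv, Complex.norm_natCast]
        have : ‖∑ k ∈ Finset.range N, _root_.id (f^[k] (f (e i)))‖ ≤ N * ‖A (e i)‖ := by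
          refine (norm_sum_le_of_le _ (fun k _ => hit k)).trans ?_
          simp
        rcases Nat.eq_zero_or_pos N with h0 | h0
        · subst h0; simp
        · have h0' : (0 : ℝ) < N := by exact_mod_cast h0
          rw [inv_mul_le_iff₀ h0']
          exact this
      calc _ ≤ ‖A (e i)‖ * ‖birkhoffAverage ℂ f _root_.id N (f (e i))‖ := norm_inner_le_norm _ _
        _ ≤ ‖A (e i)‖ * ‖A (e i)‖ := by gcongr
        _ = _ := by ring
  have hconst : ∀ N : ℕ, 0 < N →
      ∑' i, ⟪A (e i), birkhoffAverage ℂ f _root_.id N (f (e i))⟫_ℂ = diagTrace e (A * f) := by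
    intro N hN
    have h1 : ∀ i, ⟪A (e i), birkhoffAverage ℂ f _root_.id N (f (e i))⟫_ℂ =
        (N : ℂ)⁻¹ * ∑ k ∈ Finset.range N, ⟪e i, (A * (f ^ k * f)) (e i)⟫_ℂ := by
      intro i
      unfold birkhoffAverage birkhoffSum
      rw [inner_smul_right, inner_sum]
      congr 1
      refine Finset.sum_congr rfl fun k _ => ?_
      rw [← hmove, hiter]
      rfl
    simp_rw [h1]
    have s1 : ∀ k, Summable fun i => ⟪e i, (A * (f ^ k * f)) (e i)⟫_ℂ := fun k =>
      summable_mul hA ((hA.mul_left A).mul_left _)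
    rw [tsum_mul_left, Summable.tsum_finsetSum (fun k _ => s1 k)]
    have h2 : ∀ k, ∑' i, ⟪e i, (A * (f ^ k * f)) (e i)⟫_ℂ = diagTrace e (A * f) :=
      fun k => trace_const hA hBA hB k
    simp_rw [h2]
    have : (N : ℂ) ≠ 0 := by exact_mod_cast hN.ne'
    simp [this]
  have hlim2 := hlim.congr' (f₂ := fun _ => diagTrace e (A * f))
    (by filter_upwards [Filter.eventually_gt_atTop 0] with N hN using hconst N hN)
  rw [tendsto_nhds_unique tendsto_const_nhds hlim2]
  unfold diagTrace
  refine tsum_congr fun i => ?_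
  rw [← hmove]
  rfl

lemma norm_le_one_of {A B : H →L[ℂ] H} (hA : IsSelfAdjoint A) (hBsa : IsSelfAdjoint B)
    (hB : B * B = 1 - A * A) : ‖A‖ ≤ 1 := by
  refine ContinuousLinearMap.opNorm_le_bound _ zero_le_one fun x => ?_
  have key : ∀ T : H →L[ℂ] H, IsSelfAdjoint T → ⟪x, (T * T) x⟫_ℂ = ((‖T x‖ ^ 2 : ℝ) : ℂ) := by
    intro T hT
    have : ⟪x, (T * T) x⟫_ℂ = ⟪T x, T x⟫_ℂ := by
      conv_rhs => rw [← ContinuousLinearMap.adjoint_inner_right,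
        ← ContinuousLinearMap.star_eq_adjoint, hT.star_eq]
      rfl
    rw [this, inner_self_eq_norm_sq_to_K]
    simp
  have h1 := key B hBsa
  rw [hB, sub_apply, inner_sub_right, key A hA] at h1
  have h2 : ⟪x, (1 : H →L[ℂ] H) x⟫_ℂ = ((‖x‖ ^ 2 : ℝ) : ℂ) := by
    rw [ContinuousLinearMap.one_apply, inner_self_eq_norm_sq_to_K]; simp
  rw [h2, ← Complex.ofReal_sub, Complex.ofReal_inj] at h1
  rw [one_mul]
  exact abs_le_of_sq_le_sq' (by nlinarith [sq_nonneg ‖B x‖]) (norm_nonneg _) |>.2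

/-- An operator commuting with `f` and self-adjoint commutes with the projection on the fixed
space of `f`. -/
lemma comm_proj {f P : H →L[ℂ] H} (hP : IsSelfAdjoint P) (h : P * f = f * P) :
    Commute P (f.eqLocus (1 : H →L[ℂ] H)).starProjection := by
  set K := f.eqLocus (1 : H →L[ℂ] H) with hK
  have h1 : P * K.starProjection = K.starProjection * (P * K.starProjection) := by
    ext x
    have hx : K.starProjection x ∈ K := Submodule.starProjection_apply_mem K x
    have : P (K.starProjection x) ∈ K := by
      have hx' : f (K.starProjection x) = K.starProjection x := hx
      change f (P (K.starProjection x)) = P (K.starProjection x)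
      have := congrArg (fun T : H →L[ℂ] H => T (K.starProjection x)) h
      simp only [ContinuousLinearMap.mul_apply] at this
      rw [← this, hx']
    exact (Submodule.starProjection_eq_self_iff.2 this).symm
  have hs : IsSelfAdjoint K.starProjection := isSelfAdjoint_starProjection K
  have h2 := congrArg star h1
  simp only [star_mul, hP.star_eq, hs.star_eq] at h2
  change P * K.starProjection = K.starProjection * P
  rw [h1, h2, mul_assoc]

end RelCharge

open RelCharge

/-- Integrality of the relative charge: for orthogonal projections `P, Q` with `Q - P`
Hilbert–Schmidt and trace-class diagonal blocks, the generalized trace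
`tr_P(Q - P) = tr(P(Q-P)P) + tr((I-P)(Q-P)(I-P))` is an integer. -/
theorem traceP_relative_charge_integer {ι : Type*}
    (e : HilbertBasis ι ℂ H) (P Q : H →L[ℂ] H)
    (hPproj : P ∘L P = P) (hPsa : IsSelfAdjoint P)
    (hQproj : Q ∘L Q = Q) (hQsa : IsSelfAdjoint Q)
    (hHS : ∀ f : HilbertBasis ι ℂ H, Summable fun i : ι => ‖(Q - P) (f i)‖ ^ 2)
    (h1 : IsTraceClassOp e (P ∘L (Q - P) ∘L P))
    (h2 : IsTraceClassOp e ((1 - P) ∘L (Q - P) ∘L (1 - P))) :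
    ∃ n : ℤ,
      diagTrace e (P ∘L (Q - P) ∘L P) + diagTrace e ((1 - P) ∘L (Q - P) ∘L (1 - P)) =
        (n : ℂ) := by
  have hp : P * P = P := hPproj
  have hq : Q * Q = Q := hQproj
  have hA : HS e (Q - P) := hHS e
  have hAsa : IsSelfAdjoint (Q - P) := hQsa.sub hPsa
  have hBsa : IsSelfAdjoint (1 - P - Q) := ((IsSelfAdjoint.one _).sub hPsa).sub hQsa
  have hBA := alg_anti hp hq
  have hB := alg_sq hp hq
  have hn := norm_le_one_of hAsa hBsa hB
  have hdiag := alg_diag hp hq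
  have hPf := comm_proj hPsa (alg_commp hp hq)
  have hQf := comm_proj hQsa (alg_commq hp hq)
  have hlim := trace_limit hA hBA hB hAsa hn
  have hS : diagTrace e (P ∘L (Q - P) ∘L P) + diagTrace e ((1 - P) ∘L (Q - P) ∘L (1 - P)) =
      diagTrace e ((Q - P) * ((Q - P) * (Q - P))) +
        diagTrace e ((Q - P) * ((Q - P) * (1 - P - Q))) := by
    unfold diagTrace
    rw [← (h1 e).of_norm.tsum_add (h2 e).of_norm,
      ← (summable_mul hA (hA.mul_left _)).tsum_add (summable_mul hA (hA.mul_right _))]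
    refine tsum_congr fun i => ?_
    rw [← inner_add_right, ← inner_add_right]
    exact congrArg (fun T : H →L[ℂ] H => ⟪e i, T (e i)⟫_ℂ) hdiag
  have hzero : diagTrace e ((Q - P) * ((Q - P) * (1 - P - Q))) = 0 := by
    refine trace_zero_of_anti hA (hA.mul_right _) ?_
    rw [mul_assoc, hBA, mul_neg]
  rw [hS, hzero, add_zero, hlim]
  set f := (Q - P) * (Q - P) with hf
  set K := f.eqLocus (1 : H →L[ℂ] H) with hK
  have hKsa : IsStarProjection K.starProjection := isStarProjection_starProjection
  have hfK : f * K.starProjection = K.starProjection := by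
    ext x
    exact Submodule.starProjection_apply_mem K x
  have hfsa : IsSelfAdjoint f := by
    have := hAsa.pow 2
    rwa [pow_two] at this
  have hKf : K.starProjection * f = K.starProjection := by
    have := congrArg star hfK
    simpa only [star_mul, hfsa.star_eq, hKsa.isSelfAdjoint.star_eq] using this
  have hKHS : HS e K.starProjection := by
    have hfHS : HS e f := hA.mul_left _
    have := hfHS.mul_left K.starProjection
    rwa [hKf] at this
  rw [hKf]
  have hPp : IsStarProjection (P * K.starProjection) :=
    ⟨IsIdempotentElem.mul_of_commute hPf hp hKsa.isIdempotentElem,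
      (hPsa.commute_iff hKsa.isSelfAdjoint).1 hPf⟩
  have hQp : IsStarProjection (Q * K.starProjection) :=
    ⟨IsIdempotentElem.mul_of_commute hQf hq hKsa.isIdempotentElem,
      (hQsa.commute_iff hKsa.isSelfAdjoint).1 hQf⟩
  obtain ⟨m, hm⟩ := trace_proj hPp (hKHS.mul_left P)
  obtain ⟨n, hn'⟩ := trace_proj hQp (hKHS.mul_left Q)
  refine ⟨(n : ℤ) - m, ?_⟩
  have hsP : Summable fun i => ⟪e i, (P * K.starProjection) (e i)⟫_ℂ := by
    have := summable_mul (hKHS.mul_left P) hKHS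
    rwa [mul_assoc, hKsa.isIdempotentElem.eq] at this
  have hsQ : Summable fun i => ⟪e i, (Q * K.starProjection) (e i)⟫_ℂ := by
    have := summable_mul (hKHS.mul_left Q) hKHS
    rwa [mul_assoc, hKsa.isIdempotentElem.eq] at this
  push_cast
  rw [← hm, ← hn']
  unfold diagTrace
  rw [← hsQ.tsum_sub hsP]
  refine tsum_congr fun i => ?_
  rw [sub_mul, sub_apply, inner_sub_right]
end
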